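/- arXiv:1404.0660 — 2 statements merged into one kernel-verified Lean document; each statement's English description precedes it below -/
import Mathlib

section
/- For every integer n ≥ 1, ∑_{k=0}^∞ λ_k^n ≐ (1/(2π)) ∬_{ℝ²} σ_A(t,ω)^n dt dω; equivalently, with δ = arccoth(αβ), the difference 1/(2·sinh(nδ)) − 1/(2n·sinh δ·cosh^{n−1} δ) is o(αβ) as αβ → ∞ (in fact both closed forms hold: ∑_{k=0}^∞ ρ^{n(2k+1)} = 1/(2·sinh(nδ)) and (1/(2π))∬_{ℝ²} ((1/cosh δ)·e^{−t²/α²−ω²/β²})^n dt dω = 1/(2n·sinh δ·cosh^{n−1} δ)). -/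
open MeasureTheory

/-- `dlt x` is δ = arccoth x, i.e. the positive solution of coth δ = x for x > 1. -/
noncomputable def dlt (x : ℝ) : ℝ := (1/2) * Real.log ((x + 1) / (x - 1))

/-- `rho x` is ρ = e^{-δ} where coth δ = x. -/
noncomputable def rho (x : ℝ) : ℝ := Real.exp (-dlt x)

open Filter Topology

lemma dlt_pos {x : ℝ} (hx : 1 < x) : 0 < dlt x := by
  have h : 1 < (x + 1) / (x - 1) := by
    rw [one_lt_div (by linarith)]; linarith
  have := Real.log_pos h
  unfold dlt
  positivity

lemma cosh_dlt_eq {x : ℝ} (hx : 1 < x) :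
    Real.cosh (dlt x) = x * Real.sinh (dlt x) := by
  have hsq : Real.exp (dlt x) * Real.exp (dlt x) = (x + 1) / (x - 1) := by
    rw [← Real.exp_add, show dlt x + dlt x = Real.log ((x + 1) / (x - 1)) by unfold dlt; ring,
      Real.exp_log (div_pos (by linarith) (by linarith))]
  rw [eq_div_iff (by linarith)] at hsq
  have hpos := Real.exp_pos (dlt x)
  rw [Real.cosh_eq, Real.sinh_eq, Real.exp_neg]
  field_simp
  linear_combination -hsq

lemma tendsto_dlt_atTop : Tendsto dlt atTop (𝓝[>] 0) := by
  refine tendsto_nhdsWithin_iff.2 ⟨?_, ?_⟩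
  · have h1 : Tendsto (fun x : ℝ => 1 + 2 / (x - 1)) atTop (𝓝 (1 + 0)) :=
      tendsto_const_nhds.add
        (tendsto_const_nhds.div_atTop (tendsto_atTop_add_const_right _ (-1) tendsto_id))
    have h2 : Tendsto (fun x : ℝ => (1 / 2) * Real.log (1 + 2 / (x - 1))) atTop
        (𝓝 ((1 / 2) * Real.log (1 + 0))) :=
      (h1.log (by norm_num)).const_mul _
    simp only [add_zero, Real.log_one, mul_zero] at h2
    refine h2.congr' ?_
    filter_upwards [eventually_gt_atTop 1] with x hx
    have : x - 1 ≠ 0 := by linarith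
    unfold dlt
    congr 2
    field_simp
    ring
  · filter_upwards [eventually_gt_atTop 1] with x hx using dlt_pos hx

lemma tsum_odd_powers_exp_neg {d : ℝ} (hd : 0 < d) {n : ℕ} (hn : 1 ≤ n) :
    ∑' k : ℕ, (Real.exp (-d) ^ (2 * k + 1)) ^ n = 1 / (2 * Real.sinh (n * d)) := by
  have hn' : (0 : ℝ) < n := by exact_mod_cast hn
  have hnd : 0 < n * d := mul_pos hn' hd
  set r := Real.exp (-(n * d)) with hr
  have hr0 : 0 < r := Real.exp_pos _
  have hr1 : r < 1 := by rw [hr, Real.exp_lt_one_iff]; linarith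
  have hrn : Real.exp (-d) ^ n = r := by
    rw [← Real.exp_nat_mul, hr]; congr 1; ring
  have hterm : ∀ k : ℕ, (Real.exp (-d) ^ (2 * k + 1)) ^ n = r * (r ^ 2) ^ k := by
    intro k
    rw [← pow_mul, mul_comm, pow_mul, hrn]; ring
  have hr2 : r ^ 2 < 1 := by nlinarith
  rw [tsum_congr hterm, tsum_mul_left, tsum_geometric_of_lt_one (by positivity) hr2,
    Real.sinh_eq, show Real.exp (n * d) = r⁻¹ by rw [hr, Real.exp_neg, inv_inv], ← hr]
  have : 1 - r ^ 2 ≠ 0 := by linarith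
  field_simp

lemma integral_gaussian_symbol_pow (c : ℝ) {a b : ℝ} (ha : 0 < a) (hb : 0 < b) {n : ℕ}
    (hn : 1 ≤ n) :
    ∫ t : ℝ, ∫ w : ℝ, (c * Real.exp (-(t ^ 2 / a ^ 2) - w ^ 2 / b ^ 2)) ^ n =
      c ^ n * (Real.pi * a * b / n) := by
  have hn' : (0 : ℝ) < n := by exact_mod_cast hn
  have hpt : ∀ t w : ℝ, (c * Real.exp (-(t ^ 2 / a ^ 2) - w ^ 2 / b ^ 2)) ^ n =
      c ^ n * Real.exp (-(n / a ^ 2) * t ^ 2) * Real.exp (-(n / b ^ 2) * w ^ 2) := by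
    intro t w
    rw [mul_pow, ← Real.exp_nat_mul, mul_assoc, ← Real.exp_add]
    congr 2
    ring
  simp only [hpt, integral_const_mul, integral_mul_const, integral_gaussian]
  rw [mul_assoc, ← Real.sqrt_mul (by positivity)]
  congr 1
  rw [show Real.pi / (n / a ^ 2) * (Real.pi / (n / b ^ 2)) = (Real.pi * a * b / n) ^ 2 by
    field_simp, Real.sqrt_sq (by positivity)]

lemma tendsto_sinh_div_sinh_nat_mul {n : ℕ} (hn : 1 ≤ n) :
    Tendsto (fun d : ℝ => Real.sinh d / Real.sinh (n * d)) (𝓝[>] 0) (𝓝 (1 / n)) := by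
  have hn' : (n : ℝ) ≠ 0 := by positivity
  have h1 : HasDerivAt Real.sinh 1 0 := by simpa using Real.hasDerivAt_sinh 0
  have h2 : HasDerivAt (fun d : ℝ => Real.sinh (n * d)) n 0 := by
    simpa using ((hasDerivAt_id (0 : ℝ)).const_mul (n : ℝ)).sinh
  have h := (h1.tendsto_slope.div h2.tendsto_slope hn').mono_left
    (nhdsWithin_mono 0 fun x (hx : 0 < x) => hx.ne')
  refine h.congr' ?_
  filter_upwards [self_mem_nhdsWithin] with d hd
  have hd' : d ≠ 0 := (Set.mem_Ioi.1 hd).ne'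
  simp only [Pi.div_apply, slope_def_field, sub_zero, mul_zero, Real.sinh_zero]
  exact div_div_div_cancel_right₀ hd' _ _

lemma tendsto_closed_form_sub_div {n : ℕ} (hn : 1 ≤ n) :
    Tendsto (fun x : ℝ => (1 / (2 * Real.sinh (n * dlt x)) -
      1 / (2 * n * Real.sinh (dlt x) * Real.cosh (dlt x) ^ (n - 1))) / x) atTop (𝓝 0) := by
  have hn' : (0 : ℝ) < n := by exact_mod_cast hn
  have hcosh : Tendsto Real.cosh (𝓝[>] 0) (𝓝 1) := by
    have := Real.continuous_cosh.tendsto 0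
    rw [Real.cosh_zero] at this
    exact this.mono_left nhdsWithin_le_nhds
  have h := (((tendsto_sinh_div_sinh_nat_mul hn).div hcosh one_ne_zero).div_const 2).sub
    ((((hcosh.pow n).const_mul (2 * (n : ℝ))).inv₀ (by simp [hn'.ne'])))
  rw [show (1 / (n : ℝ)) / 1 / 2 - (2 * (n : ℝ) * 1 ^ n)⁻¹ = 0 by
    rw [one_pow]; field_simp; ring] at h
  refine (h.comp tendsto_dlt_atTop).congr' ?_
  filter_upwards [eventually_gt_atTop 1] with x hx
  have hd := dlt_pos hx
  have hs : 0 < Real.sinh (dlt x) := Real.sinh_pos_iff.2 hd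
  have hsn : 0 < Real.sinh (n * dlt x) := Real.sinh_pos_iff.2 (mul_pos hn' hd)
  have hc := Real.cosh_pos (dlt x)
  have hx' : x = Real.cosh (dlt x) / Real.sinh (dlt x) := by
    rw [cosh_dlt_eq hx]; field_simp
  obtain ⟨m, rfl⟩ : ∃ m, n = m + 1 := ⟨n - 1, by omega⟩
  simp only [Function.comp_apply, Pi.div_apply, Nat.add_sub_cancel]
  generalize dlt x = d at *
  subst hx'
  field_simp
  ring

/-- Monomial case of Lemma 1: `∑_k λ_k^n ≐ (1/(2π)) ∬ σ_A(t,ω)^n dt dω`.  Both sides have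
closed forms, `1/(2 sinh(nδ))` and `1/(2n sinh δ cosh^{n−1} δ)` respectively, and their
difference is `o(αβ)` as `αβ → ∞`. -/
theorem szego_monomial_case (n : ℕ) (hn : 1 ≤ n) :
    (∀ α β : ℝ, 0 < α → 0 < β → 1 < α * β →
      (∑' k : ℕ, ((rho (α*β))^(2*k+1))^n) = 1/(2 * Real.sinh ((n : ℝ) * dlt (α*β))) ∧
      (1/(2*Real.pi)) * (∫ t : ℝ, ∫ ω : ℝ,
          ((Real.cosh (dlt (α*β)))⁻¹ * Real.exp (-(t^2/α^2) - ω^2/β^2))^n)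
        = 1/(2 * (n : ℝ) * Real.sinh (dlt (α*β)) * (Real.cosh (dlt (α*β)))^(n-1))) ∧
    (∀ ε > 0, ∃ M, 1 < M ∧ ∀ α β : ℝ, 0 < α → 0 < β → M < α * β →
      |1/(2 * Real.sinh ((n : ℝ) * dlt (α*β))) -
        1/(2 * (n : ℝ) * Real.sinh (dlt (α*β)) * (Real.cosh (dlt (α*β)))^(n-1))|
        ≤ ε * (α * β)) := by
  have hn' : (0 : ℝ) < n := by exact_mod_cast hn
  refine ⟨fun α β hα hβ h => ⟨tsum_odd_powers_exp_neg (dlt_pos h) hn, ?_⟩, fun ε hε => ?_⟩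
  · have hs : 0 < Real.sinh (dlt (α * β)) := Real.sinh_pos_iff.2 (dlt_pos h)
    have hc := Real.cosh_pos (dlt (α * β))
    have hcs := cosh_dlt_eq h
    rw [integral_gaussian_symbol_pow _ hα hβ hn, inv_pow]
    obtain ⟨m, rfl⟩ : ∃ m, n = m + 1 := ⟨n - 1, by omega⟩
    rw [Nat.add_sub_cancel, pow_succ]
    generalize dlt (α * β) = d at *
    field_simp
    linear_combination -hcs
  · have hev := (tendsto_closed_form_sub_div hn).abs.eventually_lt_const
      (show |(0 : ℝ)| < ε by simpa using hε)
    obtain ⟨M, hM⟩ := eventually_atTop.1 hev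
    refine ⟨max M 2, lt_max_of_lt_right one_lt_two, fun α β hα hβ h => ?_⟩
    have hpos : 0 < α * β := mul_pos hα hβ
    have := hM (α * β) ((le_max_left _ _).trans h.le)
    rw [abs_div, abs_of_pos hpos, div_lt_iff₀ hpos] at this
    exact this.le
end

section
/- Let σ > 0 and let α, β > 0 with αβ > 1 (with δ defined by coth δ = αβ and ρ = e^{−δ}). Define the Wigner-Ville spectrum Φ(t,ω) = (σ²/(2π))·(1/cosh δ)·exp(−t²/α² − ω²/β²). Then the average energy E = ∑_{k=0}^∞ σ²·ρ^{2k+1} satisfies the exact identity E = ∬_{ℝ²} Φ(t,ω) dt dω, and moreover E ≐ (αβ/2)·σ², i.e., E(αβ) − (αβ/2)·σ² = o(αβ) as αβ → ∞. -/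
open MeasureTheory

lemma rho_pos (x : ℝ) : 0 < rho x := Real.exp_pos _

lemma rho_sq {x : ℝ} (hx : 1 < x) : rho x ^ 2 = (x - 1) / (x + 1) := by
  have h : 0 < (x + 1) / (x - 1) := div_pos (by linarith) (by linarith)
  rw [rho, dlt, ← Real.exp_nat_mul, ← inv_div (x + 1) (x - 1)]
  nth_rewrite 2 [← Real.exp_log h]
  rw [← Real.exp_neg]
  congr 1
  push_cast
  ring

lemma tsum_rho {x : ℝ} (hx : 1 < x) (s : ℝ) :
    ∑' k : ℕ, s * rho x ^ (2 * k + 1) = s * (rho x * (x + 1)) / 2 := by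
  have hx' : x + 1 ≠ 0 := by linarith
  have h1 : rho x ^ 2 < 1 := by
    rw [rho_sq hx, div_lt_one (by linarith)]
    linarith
  simp only [pow_succ _ (2 * _), pow_mul]
  rw [tsum_mul_left, tsum_mul_right, tsum_geometric_of_lt_one (sq_nonneg _) h1, rho_sq hx]
  have h2 : 1 - (x - 1) / (x + 1) = 2 / (x + 1) := by
    field_simp
    ring
  rw [h2, inv_div]
  ring

lemma inv_cosh_dlt {x : ℝ} (hx : 1 < x) :
    (Real.cosh (dlt x))⁻¹ = rho x * (x + 1) / x := by
  have hr := (rho_pos x).ne'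
  have hx' : x + 1 ≠ 0 := by linarith
  have hx0 : x ≠ 0 := by linarith
  have h2 : rho x ^ 2 * (x + 1) = x - 1 := by
    rw [rho_sq hx]
    field_simp
  have h3 : Real.exp (dlt x) = (rho x)⁻¹ := by rw [rho, Real.exp_neg, inv_inv]
  have h4 : Real.cosh (dlt x) = x / (rho x * (x + 1)) := by
    rw [Real.cosh_eq, h3, ← rho]
    field_simp
    linear_combination h2
  rw [h4, inv_div]

lemma integral_exp_neg_sq_div_sq {a : ℝ} (ha : 0 < a) :
    ∫ t : ℝ, Real.exp (-(t ^ 2 / a ^ 2)) = √Real.pi * a := by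
  have h := integral_gaussian (1 / a ^ 2)
  rw [div_div_eq_mul_div, div_one, Real.sqrt_mul Real.pi_pos.le, Real.sqrt_sq ha.le] at h
  rw [← h]
  congr 1 with t
  congr 1
  ring

lemma integral_integral_gaussian {a b : ℝ} (ha : 0 < a) (hb : 0 < b) (c : ℝ) :
    ∫ t : ℝ, ∫ w : ℝ, c * Real.exp (-(t ^ 2 / a ^ 2) - w ^ 2 / b ^ 2) =
      c * (Real.pi * (a * b)) := by
  simp only [sub_eq_add_neg, Real.exp_add, integral_const_mul, integral_mul_const,
    integral_exp_neg_sq_div_sq ha, integral_exp_neg_sq_div_sq hb]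
  linear_combination c * a * b * Real.mul_self_sqrt Real.pi_pos.le

lemma abs_rho_mul_sub_le {x : ℝ} (hx : 1 < x) : |rho x * (x + 1) - x| ≤ 1 := by
  have hr := rho_pos x
  have hx' : x + 1 ≠ 0 := by linarith
  have h : (rho x * (x + 1)) ^ 2 = x ^ 2 - 1 := by
    rw [mul_pow, rho_sq hx]
    field_simp
    ring
  have hp : 0 < rho x * (x + 1) := mul_pos hr (by linarith)
  rw [abs_le]
  constructor <;> nlinarith

/-- Average energy of the nonstationary source: the exact identity
`E = ∑_k σ²ρ^{2k+1} = ∬ Φ(t,ω) dt dω` with the Wigner-Ville spectrum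
`Φ(t,ω) = (σ²/(2π))·(1/cosh δ)·exp(−t²/α² − ω²/β²)`, and `E ≐ (αβ/2)·σ²` as `αβ → ∞`. -/
theorem average_energy_wigner_ville
    (σ : ℝ) (hσ : 0 < σ) :
    (∀ α β : ℝ, 0 < α → 0 < β → 1 < α * β →
      (∑' k : ℕ, σ^2 * (rho (α*β))^(2*k+1)) =
        ∫ t : ℝ, ∫ ω : ℝ,
          (σ^2/(2*Real.pi)) * (Real.cosh (dlt (α*β)))⁻¹ *
            Real.exp (-(t^2/α^2) - ω^2/β^2)) ∧
    (∀ ε > 0, ∃ M, 1 < M ∧ ∀ α β : ℝ, 0 < α → 0 < β → M < α * β →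
      |(∑' k : ℕ, σ^2 * (rho (α*β))^(2*k+1)) - (α*β)/2 * σ^2| ≤ ε * (α * β)) := by
  refine ⟨fun α β hα hβ h => ?_, fun ε hε => ⟨max 2 (σ ^ 2 / (2 * ε)), ?_, ?_⟩⟩
  · have hπ := Real.pi_pos.ne'
    rw [tsum_rho h, integral_integral_gaussian hα hβ, inv_cosh_dlt h]
    generalize rho (α * β) = r
    field_simp
  · exact lt_of_lt_of_le one_lt_two (le_max_left _ _)
  · intro α β _ _ h
    obtain ⟨h2, h3⟩ := max_lt_iff.mp h
    have h1 : 1 < α * β := by linarith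
    rw [div_lt_iff₀ (by positivity)] at h3
    rw [tsum_rho h1, show σ ^ 2 * (rho (α * β) * (α * β + 1)) / 2 - α * β / 2 * σ ^ 2 =
      σ ^ 2 / 2 * (rho (α * β) * (α * β + 1) - α * β) by ring, abs_mul,
      abs_of_nonneg (by positivity)]
    have := mul_le_mul_of_nonneg_left (abs_rho_mul_sub_le h1) (by positivity : 0 ≤ σ ^ 2 / 2)
    linarith
end
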